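/- Let Ω⁻ be the algebra of polynomials in the odd variables c̃₁, c̃₂, c̃₃, c̃₄ and even variables π̄₁, κ̄₁ (no dependence on ψ₁, χ₁). Define odd derivations D₁ = π̄₁ ∂/∂c̃₁ + κ̄₁ ∂/∂c̃₃ and D₂ = κ̄₁ ∂/∂c̃₂ + π̄₁ ∂/∂c̃₄ on Ω⁻. An element ω ∈ Ω⁻ satisfies D₁ω = 0 and D₂ω = 0 if and only if ω is of the form ω = p₁(π̄₁,κ̄₁) + (c̃₂π̄₁ - c̃₄κ̄₁)p₂(π̄₁,κ̄₁) + (c̃₁κ̄₁ - c̃₃π̄₁)p₃(π̄₁,κ̄₁) + (c̃₁κ̄₁ - c̃₃π̄₁)(c̃₂π̄₁ - c̃₄κ̄₁)p₄(π̄₁,κ̄₁) for polynomials p₁,…,p₄ in the commuting variables π̄₁, κ̄₁. -/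

import Mathlib

open MvPolynomial

set_option maxHeartbeats 1000000
set_option synthInstance.maxHeartbeats 400000

/-- The ℂ-algebra of polynomials in the two even ghost variables
`π̄₁ = X 0`, `κ̄₁ = X 1`. -/
noncomputable abbrev SAC.R2 : Type := MvPolynomial (Fin 2) ℂ

/-- `Ω⁻`: the free graded-commutative algebra on the four odd translation
ghosts over `ℂ[π̄₁, κ̄₁]`, realized as the exterior algebra of the free module
of rank 4. -/
noncomputable abbrev SAC.Omega : Type := ExteriorAlgebra SAC.R2 (Fin 4 → SAC.R2)

/-- The odd translation ghosts `c̃₁, c̃₂, c̃₃, c̃₄ = ctil 0, …, ctil 3`. -/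
noncomputable def SAC.ctil (i : Fin 4) : SAC.Omega :=
  ExteriorAlgebra.ι SAC.R2 (Pi.single i 1)

/-- The linear functional on the rank-4 free module determined by the
coefficient vector `w`. -/
noncomputable def SAC.dual (w : Fin 4 → SAC.R2) :
    Module.Dual SAC.R2 (Fin 4 → SAC.R2) :=
  LinearMap.lsum SAC.R2 (fun _ : Fin 4 => SAC.R2) SAC.R2
    (fun i => LinearMap.toSpanSingleton SAC.R2 SAC.R2 (w i))

/-- `D₁ = π̄₁ ∂/∂c̃₁ + κ̄₁ ∂/∂c̃₃`, as the odd derivation (interior product)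
contracting with the functional `c̃₁ ↦ π̄₁, c̃₃ ↦ κ̄₁`. -/
noncomputable def SAC.D1 : SAC.Omega →ₗ[SAC.R2] SAC.Omega :=
  CliffordAlgebra.contractLeft (Q := (0 : QuadraticForm SAC.R2 (Fin 4 → SAC.R2)))
    (SAC.dual ![X 0, 0, X 1, 0])

/-- `D₂ = κ̄₁ ∂/∂c̃₂ + π̄₁ ∂/∂c̃₄`. -/
noncomputable def SAC.D2 : SAC.Omega →ₗ[SAC.R2] SAC.Omega :=
  CliffordAlgebra.contractLeft (Q := (0 : QuadraticForm SAC.R2 (Fin 4 → SAC.R2)))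
    (SAC.dual ![0, X 1, 0, X 0])


/-- The general element with sixteen coefficients, indexed by bit masks. -/
def SACaux.F {R A : Type*} [CommRing R] [Ring A] [Algebra R A] (c : Fin 4 → A)
    (a : Fin 16 → R) : A :=
  a 0 • 1 + a 1 • (c 0) + a 2 • (c 1) + a 3 • (c 0 * (c 1)) + a 4 • (c 2) + a 5 • (c 0 * (c 2)) + a 6 • (c 1 * (c 2)) + a 7 • (c 0 * (c 1 * (c 2))) + a 8 • (c 3) + a 9 • (c 0 * (c 3)) + a 10 • (c 1 * (c 3)) + a 11 • (c 0 * (c 1 * (c 3))) + a 12 • (c 2 * (c 3)) + a 13 • (c 0 * (c 2 * (c 3))) + a 14 • (c 1 * (c 2 * (c 3))) + a 15 • (c 0 * (c 1 * (c 2 * (c 3))))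

/-- The coefficients of the contraction. -/
def SACaux.dv {R : Type*} [CommRing R] (w : Fin 4 → R) (a : Fin 16 → R) : Fin 16 → R :=
  ![w 0 * a 1 + w 1 * a 2 + w 2 * a 4 + w 3 * a 8, -w 1 * a 3 - w 2 * a 5 - w 3 * a 9, w 0 * a 3 - w 2 * a 6 - w 3 * a 10, w 2 * a 7 + w 3 * a 11, w 0 * a 5 + w 1 * a 6 - w 3 * a 12, -w 1 * a 7 + w 3 * a 13, w 0 * a 7 + w 3 * a 14, -w 3 * a 15, w 0 * a 9 + w 1 * a 10 + w 2 * a 12, -w 1 * a 11 - w 2 * a 13, w 0 * a 11 - w 2 * a 14, w 2 * a 15, w 0 * a 13 + w 1 * a 14, -w 1 * a 15, w 0 * a 15, 0]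

theorem SACaux.F_contract {R A : Type*} [CommRing R] [Ring A] [Algebra R A] (c : Fin 4 → A)
    (D : A →ₗ[R] A) (w : Fin 4 → R) (h1 : D 1 = 0) (hD : ∀ i x, D (c i * x) = w i • x - c i * D x)
    (a : Fin 16 → R) : D (SACaux.F c a) = SACaux.F c (SACaux.dv w a) := by
  have hc : ∀ i, D (c i) = w i • (1 : A) := fun i => by
    have := hD i 1
    simpa [h1] using this
  simp only [SACaux.F, map_add, map_smul, h1, hD, hc, mul_sub, mul_smul_comm, mul_one]
  simp [SACaux.dv]
  module

theorem SACaux.F_add {R A : Type*} [CommRing R] [Ring A] [Algebra R A] (c : Fin 4 → A)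
    (a b : Fin 16 → R) : SACaux.F c a + SACaux.F c b = SACaux.F c (a + b) := by
  simp only [SACaux.F, Pi.add_apply, add_smul]
  abel

theorem SACaux.F_smul {R A : Type*} [CommRing R] [Ring A] [Algebra R A] (c : Fin 4 → A)
    (r : R) (a : Fin 16 → R) : r • SACaux.F c a = SACaux.F c (r • a) := by
  simp only [SACaux.F, Pi.smul_apply, smul_add, smul_smul, smul_eq_mul]


theorem SACaux.F_mul0 {R A : Type*} [CommRing R] [Ring A] [Algebra R A] (c : Fin 4 → A)
    (h0 : ∀ i, c i * c i = 0) (hs : ∀ i j, c i * c j = -(c j * c i))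
    (a : Fin 16 → R) : c 0 * SACaux.F c a = SACaux.F c
      ![0, a 0, 0, a 2, 0, a 4, 0, a 6, 0, a 8, 0, a 10, 0, a 12, 0, a 14] := by
  have h0' : ∀ i x, c i * (c i * x) = 0 := fun i x => by rw [← mul_assoc, h0, zero_mul]
  have hs' : ∀ i j x, c i * (c j * x) = -(c j * (c i * x)) := fun i j x => by
    rw [← mul_assoc, hs, neg_mul, mul_assoc]
  simp only [SACaux.F, mul_add, mul_smul_comm, mul_one, h0, h0', mul_neg, neg_neg, mul_zero, neg_zero, smul_zero]
  simp
  try module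

theorem SACaux.F_mul1 {R A : Type*} [CommRing R] [Ring A] [Algebra R A] (c : Fin 4 → A)
    (h0 : ∀ i, c i * c i = 0) (hs : ∀ i j, c i * c j = -(c j * c i))
    (a : Fin 16 → R) : c 1 * SACaux.F c a = SACaux.F c
      ![0, 0, a 0, -a 1, 0, 0, a 4, -a 5, 0, 0, a 8, -a 9, 0, 0, a 12, -a 13] := by
  have h0' : ∀ i x, c i * (c i * x) = 0 := fun i x => by rw [← mul_assoc, h0, zero_mul]
  have hs' : ∀ i j x, c i * (c j * x) = -(c j * (c i * x)) := fun i j x => by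
    rw [← mul_assoc, hs, neg_mul, mul_assoc]
  simp only [SACaux.F, mul_add, mul_smul_comm, mul_one, h0, h0', hs 1 0, hs' 1 0, mul_neg, neg_neg, mul_zero, neg_zero, smul_zero]
  simp
  try module

theorem SACaux.F_mul2 {R A : Type*} [CommRing R] [Ring A] [Algebra R A] (c : Fin 4 → A)
    (h0 : ∀ i, c i * c i = 0) (hs : ∀ i j, c i * c j = -(c j * c i))
    (a : Fin 16 → R) : c 2 * SACaux.F c a = SACaux.F c
      ![0, 0, 0, 0, a 0, -a 1, -a 2, a 3, 0, 0, 0, 0, a 8, -a 9, -a 10, a 11] := by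
  have h0' : ∀ i x, c i * (c i * x) = 0 := fun i x => by rw [← mul_assoc, h0, zero_mul]
  have hs' : ∀ i j x, c i * (c j * x) = -(c j * (c i * x)) := fun i j x => by
    rw [← mul_assoc, hs, neg_mul, mul_assoc]
  simp only [SACaux.F, mul_add, mul_smul_comm, mul_one, h0, h0', hs 2 0, hs' 2 0, hs 2 1, hs' 2 1, mul_neg, neg_neg, mul_zero, neg_zero, smul_zero]
  simp
  try module

theorem SACaux.F_mul3 {R A : Type*} [CommRing R] [Ring A] [Algebra R A] (c : Fin 4 → A)
    (h0 : ∀ i, c i * c i = 0) (hs : ∀ i j, c i * c j = -(c j * c i))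
    (a : Fin 16 → R) : c 3 * SACaux.F c a = SACaux.F c
      ![0, 0, 0, 0, 0, 0, 0, 0, a 0, -a 1, -a 2, a 3, -a 4, a 5, a 6, -a 7] := by
  have h0' : ∀ i x, c i * (c i * x) = 0 := fun i x => by rw [← mul_assoc, h0, zero_mul]
  have hs' : ∀ i j x, c i * (c j * x) = -(c j * (c i * x)) := fun i j x => by
    rw [← mul_assoc, hs, neg_mul, mul_assoc]
  simp only [SACaux.F, mul_add, mul_smul_comm, mul_one, h0, h0', hs 3 0, hs' 3 0, hs 3 1, hs' 3 1, hs 3 2, hs' 3 2, mul_neg, neg_neg, mul_zero, neg_zero, smul_zero]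
  simp
  try module

theorem SACaux.F_inj {R A : Type*} [CommRing R] [Ring A] [Algebra R A] (c : Fin 4 → A)
    (D : (Fin 4 → R) → A →ₗ[R] A) (h1 : ∀ w, D w 1 = 0)
    (hD : ∀ w i x, D w (c i * x) = w i • x - c i * D w x)
    (e : A →ₐ[R] R) (he : ∀ i, e (c i) = 0)
    (a : Fin 16 → R) (ha : SACaux.F c a = 0) : ∀ i, a i = 0 := by
  have key : ∀ a : Fin 16 → R, SACaux.F c a = 0 → a 0 = 0 := fun a ha => by
    have := congrArg e ha
    simpa [SACaux.F, he] using this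
  have step : ∀ (a : Fin 16 → R) w, SACaux.F c a = 0 → SACaux.F c (SACaux.dv w a) = 0 := by
    intro a w h
    rw [← SACaux.F_contract c (D w) w (h1 w) (hD w), h, map_zero]
  have s0 := fun (a : Fin 16 → R) (h : SACaux.F c a = 0) => step a (Pi.single 0 1) h
  have s1 := fun (a : Fin 16 → R) (h : SACaux.F c a = 0) => step a (Pi.single 1 1) h
  have s2 := fun (a : Fin 16 → R) (h : SACaux.F c a = 0) => step a (Pi.single 2 1) h
  have s3 := fun (a : Fin 16 → R) (h : SACaux.F c a = 0) => step a (Pi.single 3 1) h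
  intro i
  fin_cases i
  · simpa [SACaux.dv] using key _ (ha)
  · simpa [SACaux.dv] using key _ (s0 _ (ha))
  · simpa [SACaux.dv] using key _ (s1 _ (ha))
  · simpa [SACaux.dv] using key _ (s1 _ (s0 _ (ha)))
  · simpa [SACaux.dv] using key _ (s2 _ (ha))
  · simpa [SACaux.dv] using key _ (s2 _ (s0 _ (ha)))
  · simpa [SACaux.dv] using key _ (s2 _ (s1 _ (ha)))
  · simpa [SACaux.dv] using key _ (s2 _ (s1 _ (s0 _ (ha))))
  · simpa [SACaux.dv] using key _ (s3 _ (ha))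
  · simpa [SACaux.dv] using key _ (s3 _ (s0 _ (ha)))
  · simpa [SACaux.dv] using key _ (s3 _ (s1 _ (ha)))
  · simpa [SACaux.dv] using key _ (s3 _ (s1 _ (s0 _ (ha))))
  · simpa [SACaux.dv] using key _ (s3 _ (s2 _ (ha)))
  · simpa [SACaux.dv] using key _ (s3 _ (s2 _ (s0 _ (ha))))
  · simpa [SACaux.dv] using key _ (s3 _ (s2 _ (s1 _ (ha))))
  · simpa [SACaux.dv] using key _ (s3 _ (s2 _ (s1 _ (s0 _ (ha)))))

theorem SACaux.koszul (x y : SAC.R2) (h : X 0 * x + X 1 * y = 0) :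
    ∃ q, x = X 1 * q ∧ y = - (X 0 * q) := by
  have hd : (X 1 : SAC.R2) ∣ X 0 * x := ⟨-y, by linear_combination h⟩
  have hp : Prime (X 1 : SAC.R2) := MvPolynomial.X_prime
  rcases hp.dvd_or_dvd hd with h' | ⟨q, hq⟩
  · simp [MvPolynomial.X_dvd_X] at h'
  · refine ⟨q, hq, ?_⟩
    apply mul_left_cancel₀ hp.ne_zero
    rw [hq] at h
    linear_combination h

theorem SACaux.contract (w : Fin 4 → SAC.R2) (i : Fin 4) (x : SAC.Omega) :
    CliffordAlgebra.contractLeft (Q := (0 : QuadraticForm SAC.R2 (Fin 4 → SAC.R2)))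
      (SAC.dual w) (SAC.ctil i * x) = w i • x - SAC.ctil i *
      CliffordAlgebra.contractLeft (Q := (0 : QuadraticForm SAC.R2 (Fin 4 → SAC.R2)))
      (SAC.dual w) x := by
  have h : SAC.dual w (Pi.single i 1) = w i := by
    simp [SAC.dual, LinearMap.lsum_apply, Pi.single_apply]
  have := CliffordAlgebra.contractLeft_ι_mul
    (Q := (0 : QuadraticForm SAC.R2 (Fin 4 → SAC.R2))) (SAC.dual w) (Pi.single i 1) x
  rw [h] at this
  exact this

theorem SACaux.sq (i : Fin 4) : SAC.ctil i * SAC.ctil i = 0 := ExteriorAlgebra.ι_sq_zero _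

theorem SACaux.swap (i j : Fin 4) : SAC.ctil i * SAC.ctil j = -(SAC.ctil j * SAC.ctil i) :=
  eq_neg_of_add_eq_zero_left (ExteriorAlgebra.ι_add_mul_swap _ _)

theorem SACaux.inj (a : Fin 16 → SAC.R2) (ha : SACaux.F SAC.ctil a = 0) : ∀ i, a i = 0 := by
  refine SACaux.F_inj SAC.ctil (fun w => CliffordAlgebra.contractLeft
    (Q := (0 : QuadraticForm SAC.R2 (Fin 4 → SAC.R2))) (SAC.dual w))
    (fun w => CliffordAlgebra.contractLeft_one _ _) SACaux.contract ExteriorAlgebra.algebraMapInv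
    (fun i => ?_) a ha
  simp [SAC.ctil, ExteriorAlgebra.algebraMapInv]

theorem SACaux.span (x : SAC.Omega) : ∃ a : Fin 16 → SAC.R2, x = SACaux.F SAC.ctil a := by
  induction x using CliffordAlgebra.left_induction with
  | algebraMap r =>
    refine ⟨Pi.single 0 r, ?_⟩
    simp [SACaux.F, Algebra.algebraMap_eq_smul_one]
  | add x y hx hy =>
    obtain ⟨a, rfl⟩ := hx
    obtain ⟨b, rfl⟩ := hy
    exact ⟨_, SACaux.F_add _ _ _⟩
  | ι_mul x m hx =>
    obtain ⟨a, rfl⟩ := hx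
    have hm : ExteriorAlgebra.ι SAC.R2 m = m 0 • SAC.ctil 0 + m 1 • SAC.ctil 1
        + m 2 • SAC.ctil 2 + m 3 • SAC.ctil 3 := by
      have : m = m 0 • Pi.single 0 1 + m 1 • Pi.single 1 1 + m 2 • Pi.single 2 1
          + m 3 • Pi.single 3 1 := by
        ext1 i
        fin_cases i <;> simp
      conv_lhs => rw [this]
      simp only [map_add, map_smul, SAC.ctil]
    change ∃ b : Fin 16 → SAC.R2, ExteriorAlgebra.ι SAC.R2 m * SACaux.F SAC.ctil a = SACaux.F SAC.ctil b
    rw [hm]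
    simp only [add_mul, smul_mul_assoc]
    rw [SACaux.F_mul0 _ SACaux.sq SACaux.swap, SACaux.F_mul1 _ SACaux.sq SACaux.swap,
      SACaux.F_mul2 _ SACaux.sq SACaux.swap, SACaux.F_mul3 _ SACaux.sq SACaux.swap]
    simp only [SACaux.F_smul, SACaux.F_add]
    exact ⟨_, rfl⟩

theorem SACaux.D1F (a : Fin 16 → SAC.R2) : SAC.D1 (SACaux.F SAC.ctil a) =
    SACaux.F SAC.ctil (SACaux.dv ![X 0, 0, X 1, 0] a) :=
  SACaux.F_contract _ SAC.D1 _ (CliffordAlgebra.contractLeft_one _ _) (SACaux.contract _) a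

theorem SACaux.D2F (a : Fin 16 → SAC.R2) : SAC.D2 (SACaux.F SAC.ctil a) =
    SACaux.F SAC.ctil (SACaux.dv ![0, X 1, 0, X 0] a) :=
  SACaux.F_contract _ SAC.D2 _ (CliffordAlgebra.contractLeft_one _ _) (SACaux.contract _) a

theorem SACaux.form {R A : Type*} [CommRing R] [Ring A] [Algebra R A] (c : Fin 4 → A)
    (hs : ∀ i j, c i * c j = -(c j * c i)) (x y p1 p2 p3 p4 : R) :
    algebraMap R A p1 + p2 • (x • c 1 - y • c 3) + p3 • (y • c 0 - x • c 2)
      + p4 • ((y • c 0 - x • c 2) * (x • c 1 - y • c 3)) =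
    SACaux.F c ![p1, y * p3, x * p2, x * y * p4, -(x * p3), 0, x * x * p4, 0,
      -(y * p2), -(y * y * p4), 0, 0, x * y * p4, 0, 0, 0] := by
  simp only [SACaux.F, Algebra.algebraMap_eq_smul_one, mul_sub, sub_mul, smul_mul_assoc,
    mul_smul_comm, hs 2 1]
  simp
  module


theorem SACaux.F_zero {R A : Type*} [CommRing R] [Ring A] [Algebra R A] (c : Fin 4 → A)
    (a : Fin 16 → R) (h : ∀ i, a i = 0) : SACaux.F c a = 0 := by
  simp [SACaux.F, h]

/-- Lemma 4D1(i): `ω ∈ Ω⁻` satisfies `D₁ω = 0` and `D₂ω = 0`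
iff `ω = p₁ + (c̃₂π̄₁ - c̃₄κ̄₁)p₂ + (c̃₁κ̄₁ - c̃₃π̄₁)p₃
+ (c̃₁κ̄₁ - c̃₃π̄₁)(c̃₂π̄₁ - c̃₄κ̄₁)p₄` with `pᵢ ∈ ℂ[π̄₁, κ̄₁]`. -/
theorem stmt_10 (ω : SAC.Omega) :
    (SAC.D1 ω = 0 ∧ SAC.D2 ω = 0) ↔
      ∃ p1 p2 p3 p4 : SAC.R2,
        ω = algebraMap SAC.R2 SAC.Omega p1
          + p2 • ((X 0 : SAC.R2) • SAC.ctil 1 - (X 1 : SAC.R2) • SAC.ctil 3)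
          + p3 • ((X 1 : SAC.R2) • SAC.ctil 0 - (X 0 : SAC.R2) • SAC.ctil 2)
          + p4 • (((X 1 : SAC.R2) • SAC.ctil 0 - (X 0 : SAC.R2) • SAC.ctil 2) *
              ((X 0 : SAC.R2) • SAC.ctil 1 - (X 1 : SAC.R2) • SAC.ctil 3)) := by
  simp only [SACaux.form SAC.ctil SACaux.swap]
  constructor
  · rintro ⟨h1, h2⟩
    obtain ⟨a, rfl⟩ := SACaux.span ω
    rw [SACaux.D1F] at h1
    rw [SACaux.D2F] at h2
    have g1 := SACaux.inj _ h1
    have g2 := SACaux.inj _ h2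
    clear h1 h2
    simp only [Fin.forall_fin_succ, SACaux.dv] at g1 g2
    simp at g1 g2
    obtain ⟨e1, e5, e3, e7, -, -, e9, e13, -, e15, -, -⟩ := g1
    obtain ⟨f2, f3, e10, e11, -, -, e14, -⟩ := g2
    obtain ⟨p3, h1, h4⟩ := SACaux.koszul _ _ e1
    obtain ⟨q, h8, h2⟩ := SACaux.koszul (a 8) (a 2) (by linear_combination f2)
    obtain ⟨q1, h3, h6⟩ := SACaux.koszul (a 3) (-a 6) (by linear_combination e3)
    obtain ⟨q2, h9, h12⟩ := SACaux.koszul _ _ e9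
    have hq : (X 0 : SAC.R2) * q2 + X 1 * q1 = 0 := by
      apply mul_left_cancel₀ (MvPolynomial.X_ne_zero (R := ℂ) (1 : Fin 2))
      rw [h3, h9] at f3
      linear_combination -f3
    obtain ⟨s, k2, k1⟩ := SACaux.koszul _ _ hq
    have h6' : a 6 = X 0 * q1 := by linear_combination -h6
    refine ⟨a 0, -q, p3, -s, ?_⟩
    congr 1
    ext1 i
    fin_cases i <;> simp [h1, h2, h3, h4, e5, h6', e7, h8, h9, e10, e11, h12, e13, e14, e15, k1, k2]
      <;> ring
  · rintro ⟨p1, p2, p3, p4, rfl⟩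
    rw [SACaux.D1F, SACaux.D2F]
    constructor
    · refine SACaux.F_zero _ _ fun i => ?_
      fin_cases i <;> simp [SACaux.dv] <;> ring
    · refine SACaux.F_zero _ _ fun i => ?_
      fin_cases i <;> simp [SACaux.dv] <;> ring
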